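/- There exist constants C > 0 and c ≥ 0 such that for every integer n ≥ 2, every integer W ≥ 1, every finite vertex set V with |V| = n, and all distinct s, t ∈ V, there is a deterministic cut-query decision tree over V of depth at most C·n^{5/3}·W·(log n)^c which, for every capacitated undirected graph on V with integer capacities bounded by W, when run on that graph outputs a maximum s-t flow of the graph. -/

import Mathlib

/-- A deterministic cut-query decision tree over the vertex set `V` with
outputs in `α`: either a leaf labeled by an output value, or an internal node
labeled by a query set `Q ⊆ V` together with a child tree for every possible
answer `a ∈ ℕ`. -/
inductive CutQueryTree (V : Type) (α : Type) : Type
  | leaf : α → CutQueryTree V α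
  | node : Finset V → (ℕ → CutQueryTree V α) → CutQueryTree V α

namespace CutQueryTree

/-- Running a cut-query decision tree against an answer oracle
`ans : Finset V → ℕ`: at an internal node labeled `Q` we move to the child
indexed by `ans Q`; the output is the label of the leaf reached. -/
def run {V α : Type} : CutQueryTree V α → (Finset V → ℕ) → α
  | leaf a, _ => a
  | node Q child, ans => (child (ans Q)).run ans

/-- `DepthLE T d`: every root-to-leaf path of `T` passes through at most `d`
internal nodes (i.e. the tree makes at most `d` queries). -/
inductive DepthLE {V α : Type} : CutQueryTree V α → ℕ → Prop
  | leaf (a : α) (d : ℕ) : DepthLE (leaf a) d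
  | node (Q : Finset V) (child : ℕ → CutQueryTree V α) (d : ℕ)
      (h : ∀ a : ℕ, DepthLE (child a) d) : DepthLE (node Q child) (d + 1)

end CutQueryTree

/-- `f` is an `s`-`t` flow for the integer capacity function `cap`:
skew-symmetric, capacity-respecting, and conserving at all vertices other than
`s` and `t`. -/
def IsFlow {V : Type} [Fintype V] (cap : V → V → ℕ) (s t : V)
    (f : V → V → ℝ) : Prop :=
  (∀ u v, f u v = - f v u) ∧ (∀ u v, f u v ≤ (cap u v : ℝ)) ∧
    (∀ u, u ≠ s → u ≠ t → ∑ v, f u v = 0)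


open Relation

namespace CutQueryTree

variable {V : Type} [Fintype V] [DecidableEq V] {α : Type}

/-- The answer to a cut query. -/
def cutVal (cap : V → V → ℕ) (Q : Finset V) : ℕ := ∑ u ∈ Q, ∑ v ∈ Qᶜ, cap u v

omit [Fintype V] [DecidableEq V] in
theorem DepthLE.mono {T : CutQueryTree V α} {k l : ℕ} (h : DepthLE T k) (hkl : k ≤ l) :
    DepthLE T l := by
  induction h generalizing l with
  | leaf a d => exact DepthLE.leaf a l
  | node Q child d _ ih =>
    obtain ⟨l, rfl⟩ : ∃ m, l = m + 1 := ⟨l - 1, by omega⟩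
    exact DepthLE.node Q child l fun a => ih a (by omega)

/-- Some tree of depth at most `k` outputs, on every capacity function in `S`,
an output related to it by `P`. -/
def Solvable (P : (V → V → ℕ) → α → Prop) (S : Set (V → V → ℕ)) (k : ℕ) : Prop :=
  ∃ T : CutQueryTree V α, DepthLE T k ∧ ∀ cap ∈ S, P cap (T.run (cutVal cap))

namespace Solvable

variable {P : (V → V → ℕ) → α → Prop} {S S' : Set (V → V → ℕ)} {k l : ℕ}

theorem mono (h : Solvable P S k) (hS : S' ⊆ S) (hkl : k ≤ l) : Solvable P S' l := by
  obtain ⟨T, hT, hP⟩ := h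
  exact ⟨T, hT.mono hkl, fun cap hc => hP cap (hS hc)⟩

theorem of_output (a : α) (h : ∀ cap ∈ S, P cap a) : Solvable P S k :=
  ⟨.leaf a, .leaf a k, h⟩

theorem query (Q : Finset V) (h : ∀ a, Solvable P {cap ∈ S | cutVal cap Q = a} k) :
    Solvable P S (k + 1) := by
  choose T hT hP using h
  exact ⟨.node Q T, .node Q T k hT, fun cap hc => hP _ cap ⟨hc, rfl⟩⟩

end Solvable

theorem cutVal_insert {cap : V → V → ℕ} (hsymm : ∀ u v, cap u v = cap v u) {u : V}
    {A : Finset V} (hu : u ∉ A) :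
    cutVal cap (insert u A) + 2 * ∑ v ∈ A, cap u v = cutVal cap {u} + cutVal cap A := by
  have hd : Disjoint ({u} : Finset V) A := by simpa using hu
  have hA : Aᶜ = insert u (insert u A)ᶜ := by
    ext x; by_cases hx : x = u <;> simp_all
  have h1 : cutVal cap A = ∑ x ∈ A, (cap u x + ∑ v ∈ (insert u A)ᶜ, cap x v) := by
    unfold cutVal
    refine Finset.sum_congr rfl fun x _ => ?_
    rw [hA, Finset.sum_insert (by simp), hsymm x u]
  have h2 : ({u} : Finset V)ᶜ = A ∪ (insert u A)ᶜ := by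
    ext x; by_cases hx : x = u <;> by_cases hxA : x ∈ A <;> simp_all
  have h3 : cutVal cap {u} = ∑ v ∈ A, cap u v + ∑ v ∈ (insert u A)ᶜ, cap u v := by
    unfold cutVal
    rw [Finset.sum_singleton, h2, Finset.sum_union]
    rw [Finset.disjoint_left]
    intro x hx; simp [hx]
  have h4 : cutVal cap (insert u A) =
      ∑ v ∈ (insert u A)ᶜ, cap u v + ∑ x ∈ A, ∑ v ∈ (insert u A)ᶜ, cap x v := by
    unfold cutVal
    rw [Finset.sum_insert hu]
  rw [h1, h3, h4, Finset.sum_add_distrib]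
  ring

namespace Solvable

variable {P : (V → V → ℕ) → α → Prop} {S : Set (V → V → ℕ)} {k : ℕ}

theorem query_star (hsymm : ∀ cap ∈ S, ∀ u v, cap u v = cap v u) {u : V} {A : Finset V}
    (hu : u ∉ A) (h : ∀ a, Solvable P {cap ∈ S | ∑ v ∈ A, cap u v = a} k) :
    Solvable P S (k + 3) := by
  refine query (insert u A) fun a => query {u} fun b => query A fun c => ?_
  refine (h ((b + c - a) / 2)).mono ?_ le_rfl
  rintro cap ⟨⟨⟨hc, rfl⟩, rfl⟩, rfl⟩
  refine ⟨hc, ?_⟩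
  have := cutVal_insert (hsymm cap hc) hu
  omega

theorem search_of_exists [Nonempty α] (f : V → V → ℤ) {u : V} (m : ℕ) :
    ∀ (S : Set (V → V → ℕ)) (A : Finset V), u ∉ A → A.card ≤ 2 ^ m →
      (∀ cap ∈ S, ∀ u v, cap u v = cap v u) → (∀ cap ∈ S, ∀ u v, f u v ≤ cap u v) →
      (∀ cap ∈ S, ∃ v ∈ A, f u v < cap u v) →
      (∀ v ∈ A, Solvable P {cap ∈ S | f u v < cap u v} k) →
      Solvable P S (k + 3 * m) := by
  induction m with
  | zero =>
    intro S A hu hA _ _ hex h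
    rcases S.eq_empty_or_nonempty with rfl | ⟨cap, hc⟩
    · exact of_output (Classical.arbitrary α) (by simp)
    · obtain ⟨v, hv, -⟩ := hex cap hc
      refine (h v hv).mono (fun c hcS => ⟨hcS, ?_⟩) (by simp)
      obtain ⟨w, hw, hlt⟩ := hex c hcS
      rwa [Finset.card_le_one.1 (by simpa using hA) v hv w hw]
  | succ m ih =>
    intro S A hu hA hsymm hle hex h
    obtain ⟨B, hBA, hB⟩ := Finset.exists_subset_card_eq (s := A) (n := A.card / 2) (by omega)
    have hpow : 2 ^ (m + 1) = 2 * 2 ^ m := by ring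
    have hC : (A \ B).card ≤ 2 ^ m := by
      have : (A \ B).card = A.card - B.card := Finset.card_sdiff_of_subset hBA
      omega
    have huB : u ∉ B := fun hx => hu (hBA hx)
    rw [show k + 3 * (m + 1) = k + 3 * m + 3 by ring]
    refine query_star hsymm huB fun a => ?_
    by_cases ha : (a : ℤ) = ∑ v ∈ B, f u v
    · refine ih _ (A \ B) (by simp [hu]) hC (fun c hc => hsymm c hc.1) (fun c hc => hle c hc.1)
        ?_ fun v hv => (h v (Finset.sdiff_subset hv)).mono (fun c hc => ⟨hc.1.1, hc.2⟩) le_rfl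
      rintro c ⟨hc, hca⟩
      obtain ⟨v, hv, hlt⟩ := hex c hc
      refine ⟨v, Finset.mem_sdiff.2 ⟨hv, fun hvB => ?_⟩, hlt⟩
      have : ∑ v ∈ B, f u v < ∑ v ∈ B, (c u v : ℤ) :=
        Finset.sum_lt_sum (fun i _ => hle c hc u i) ⟨v, hvB, hlt⟩
      rw [← ha, ← hca] at this
      push_cast at this
      exact lt_irrefl _ this
    · refine ih _ B huB (by omega) (fun c hc => hsymm c hc.1) (fun c hc => hle c hc.1)
        ?_ fun v hv => (h v (hBA hv)).mono (fun c hc => ⟨hc.1.1, hc.2⟩) le_rfl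
      rintro c ⟨hc, hca⟩
      by_contra! hno
      refine ha ?_
      rw [← hca]
      push_cast
      exact Finset.sum_congr rfl fun v hv => le_antisymm (hno v hv) (hle c hc u v)

end Solvable
end CutQueryTree

namespace CutQueryTree.Solvable

variable {V : Type} [Fintype V] [DecidableEq V] {α : Type} [Nonempty α]
  {P : (V → V → ℕ) → α → Prop} {S : Set (V → V → ℕ)} {k : ℕ}

/-- Binary search for an arc leaving `u` towards `A` on which the capacity exceeds `f`. -/
theorem search (hsymm : ∀ cap ∈ S, ∀ u v, cap u v = cap v u) {f : V → V → ℤ}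
    (hle : ∀ cap ∈ S, ∀ u v, f u v ≤ cap u v) {u : V} {A : Finset V} (hu : u ∉ A) {m : ℕ}
    (hA : A.card ≤ 2 ^ m) (hno : Solvable P {cap ∈ S | ∀ v ∈ A, (cap u v : ℤ) ≤ f u v} k)
    (h : ∀ v ∈ A, Solvable P {cap ∈ S | f u v < cap u v} k) :
    Solvable P S (k + 3 * (m + 1)) := by
  rw [show k + 3 * (m + 1) = k + 3 * m + 3 by ring]
  refine query_star hsymm hu fun a => ?_
  by_cases ha : (a : ℤ) = ∑ v ∈ A, f u v
  · refine hno.mono ?_ (by omega)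
    rintro c ⟨hc, hca⟩
    refine ⟨hc, ?_⟩
    by_contra! hex
    have : ∑ v ∈ A, f u v < ∑ v ∈ A, (c u v : ℤ) :=
      Finset.sum_lt_sum (fun i _ => hle c hc u i) hex
    rw [← ha, ← hca] at this
    push_cast at this
    exact lt_irrefl _ this
  · refine search_of_exists f m _ A hu hA (fun c hc => hsymm c hc.1) (fun c hc => hle c hc.1)
      ?_ fun v hv => (h v hv).mono (fun c hc => ⟨hc.1.1, hc.2⟩) le_rfl
    rintro c ⟨hc, hca⟩
    by_contra! hno
    refine ha ?_
    rw [← hca]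
    push_cast
    exact Finset.sum_congr rfl fun v hv => le_antisymm (hno v hv) (hle c hc u v)

end CutQueryTree.Solvable

section Flow

variable {V : Type} [Fintype V] [DecidableEq V]

theorem sum_cut_eq_sum_source {R : Type*} [CommRing R] [LinearOrder R] [IsStrictOrderedRing R]
    {s t : V} {g : V → V → R} (hskew : ∀ u v, g u v = -g v u)
    (hcons : ∀ u, u ≠ s → u ≠ t → ∑ v, g u v = 0) {X : Finset V} (hs : s ∈ X) (ht : t ∉ X) :
    ∑ u ∈ X, ∑ v ∈ Xᶜ, g u v = ∑ v, g s v := by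
  have hX : ∑ u ∈ X, ∑ v ∈ X, g u v = 0 := by
    have h : ∑ u ∈ X, ∑ v ∈ X, g u v = -∑ u ∈ X, ∑ v ∈ X, g u v := by
      conv_lhs => rw [Finset.sum_comm]
      simp_rw [← Finset.sum_neg_distrib]
      exact Finset.sum_congr rfl fun u _ => Finset.sum_congr rfl fun v _ => hskew v u
    linarith
  have h1 : ∑ u ∈ X, ∑ v, g u v = ∑ v, g s v :=
    Finset.sum_eq_single_of_mem s hs fun u hu hus =>
      hcons u hus (by rintro rfl; exact ht hu)
  rw [← h1]
  simp_rw [← Finset.sum_add_sum_compl X]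
  rw [Finset.sum_add_distrib, hX, zero_add]

/-- Symmetric capacities bounded by `W` that vanish on the diagonal. -/
structure IsNetwork (W : ℕ) (cap : V → V → ℕ) : Prop where
  symm : ∀ u v, cap u v = cap v u
  diag : ∀ v, cap v v = 0
  le : ∀ u v, cap u v ≤ W

/-- Integral `s`-`t` flows. -/
structure IsIntFlow (cap : V → V → ℕ) (s t : V) (f : V → V → ℤ) : Prop where
  skew : ∀ u v, f u v = -f v u
  le : ∀ u v, f u v ≤ cap u v
  cons : ∀ u, u ≠ s → u ≠ t → ∑ v, f u v = 0

/-- Maximum `s`-`t` flows. -/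
def IsMaxFlow (cap : V → V → ℕ) (s t : V) (f : V → V → ℝ) : Prop :=
  IsFlow cap s t f ∧ ∀ g : V → V → ℝ, IsFlow cap s t g → ∑ v, g s v ≤ ∑ v, f s v

/-- Some `s`-`t` cut has capacity at most `j` more than the value of `f`. -/
def HasCutWithin (cap : V → V → ℕ) (s t : V) (f : V → V → ℤ) (j : ℕ) : Prop :=
  ∃ X : Finset V, s ∈ X ∧ t ∉ X ∧ (CutQueryTree.cutVal cap X : ℤ) ≤ ∑ v, f s v + j

theorem IsIntFlow.sum_source_le {cap : V → V → ℕ} {s t : V} {f : V → V → ℤ}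
    (hf : IsIntFlow cap s t f) {X : Finset V} (hs : s ∈ X) (ht : t ∉ X) :
    ∑ v, f s v ≤ CutQueryTree.cutVal cap X := by
  rw [← sum_cut_eq_sum_source hf.skew hf.cons hs ht]
  unfold CutQueryTree.cutVal
  push_cast
  exact Finset.sum_le_sum fun u _ => Finset.sum_le_sum fun v _ => hf.le u v

theorem IsIntFlow.isMaxFlow {cap : V → V → ℕ} {s t : V} {f : V → V → ℤ}
    (hf : IsIntFlow cap s t f) (h : HasCutWithin cap s t f 0) :
    IsMaxFlow cap s t fun u v => (f u v : ℝ) := by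
  refine ⟨⟨fun u v => ?_, fun u v => ?_, fun u hs ht => ?_⟩, fun g hg => ?_⟩
  · simpa using congrArg (Int.cast : ℤ → ℝ) (hf.skew u v)
  · simpa using (Int.cast_le (R := ℝ)).2 (hf.le u v)
  · simpa using congrArg (Int.cast : ℤ → ℝ) (hf.cons u hs ht)
  · obtain ⟨X, hs, ht, hX⟩ := h
    rw [← sum_cut_eq_sum_source hg.1 hg.2.2 hs ht]
    calc ∑ u ∈ X, ∑ v ∈ Xᶜ, g u v ≤ ∑ u ∈ X, ∑ v ∈ Xᶜ, (cap u v : ℝ) :=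
          Finset.sum_le_sum fun u _ => Finset.sum_le_sum fun v _ => hg.2.1 u v
      _ = ((CutQueryTree.cutVal cap X : ℤ) : ℝ) := by simp [CutQueryTree.cutVal]
      _ ≤ ((∑ v, f s v + (0 : ℕ) : ℤ) : ℝ) := Int.cast_le.2 hX
      _ = ∑ v, (f s v : ℝ) := by simp

/-- `g` sends one unit of flow from `s` to `t`, using only arcs related by `R`. -/
structure IsUnitFlow (R : V → V → Prop) (s t : V) (g : V → V → ℤ) : Prop where
  skew : ∀ u v, g u v = -g v u
  le_one : ∀ u v, g u v ≤ 1
  rel : ∀ u v, 0 < g u v → R u v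
  sum_eq : ∀ u, ∑ v, g u v = (if u = s then 1 else 0) - if u = t then 1 else 0

theorem exists_isUnitFlow_of_decreasing {R : V → V → Prop} {d : V → ℕ}
    (hR : ∀ u v, R u v → d v < d u) {s t : V} (h : ReflTransGen R s t) :
    ∃ g, IsUnitFlow R s t g ∧ ∀ u v, g u v ≠ 0 → d u ≤ d s := by
  induction h using ReflTransGen.head_induction_on with
  | refl => exact ⟨fun _ _ => 0, ⟨by simp, by simp, by simp, by simp⟩, by simp⟩
  | @head a b hab _ ih =>
    obtain ⟨g, hg, hd⟩ := ih
    have hlt := hR a b hab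
    have hne : a ≠ b := by rintro rfl; exact lt_irrefl _ hlt
    have ha : ∀ v, g a v = 0 := fun v => by
      by_contra hv; have := hd a v hv; omega
    have ha' : ∀ v, g v a = 0 := fun v => by rw [hg.skew, ha, neg_zero]
    refine ⟨fun u v => g u v + ((if u = a ∧ v = b then 1 else 0) -
      if v = a ∧ u = b then 1 else 0), ⟨?_, ?_, ?_, ?_⟩, ?_⟩
    · intro u v
      rw [hg.skew u v]; ring
    · intro u v
      by_cases h1 : u = a ∧ v = b
      · obtain ⟨rfl, rfl⟩ := h1
        simp [ha, hne]
      · have := hg.le_one u v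
        simp only [h1, if_false]
        split_ifs <;> omega
    · intro u v
      by_cases h1 : u = a ∧ v = b
      · obtain ⟨rfl, rfl⟩ := h1
        exact fun _ => hab
      · intro h2
        refine hg.rel u v ?_
        simp only [h1, if_false] at h2
        split_ifs at h2 <;> omega
    · intro u
      rw [Finset.sum_add_distrib, hg.sum_eq, Finset.sum_sub_distrib]
      have e1 : ∑ v, (if u = a ∧ v = b then (1 : ℤ) else 0) = if u = a then 1 else 0 := by
        by_cases hu : u = a <;> simp [hu]
      have e2 : ∑ v, (if v = a ∧ u = b then (1 : ℤ) else 0) = if u = b then 1 else 0 := by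
        by_cases hu : u = b <;> simp [hu]
      rw [e1, e2]; ring
    · intro u v h0
      by_cases h1 : u = a ∧ v = b
      · rw [h1.1]
      by_cases h2 : v = a ∧ u = b
      · rw [h2.2]; exact hlt.le
      · simp only [h1, h2, if_false, sub_zero, add_zero] at h0
        exact (hd u v h0).trans hlt.le

omit [Fintype V] in
theorem exists_decreasing_of_reflTransGen {R : V → V → Prop} {s t : V} (h : ReflTransGen R s t) :
    ∃ d : V → ℕ, ReflTransGen (fun u v => R u v ∧ d v < d u) s t := by
  induction h using ReflTransGen.head_induction_on with
  | refl => exact ⟨0, .refl⟩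
  | @head a b hab hbt ih =>
    obtain ⟨d, hd⟩ := ih
    by_cases hat : ReflTransGen (fun u v => R u v ∧ d v < d u) a t
    · exact ⟨d, hat⟩
    have hne : ∀ x, ReflTransGen (fun u v => R u v ∧ d v < d u) x t → x ≠ a := by
      rintro x hx rfl; exact hat hx
    refine ⟨Function.update d a (d b + 1), .head ⟨hab, ?_⟩ ?_⟩
    · rw [Function.update_of_ne (hne b hd), Function.update_self]; omega
    · generalize d b + 1 = c
      clear hab hbt
      induction hd using ReflTransGen.head_induction_on with
      | refl => exact .refl
      | @head x y hxy hyt ih =>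
        refine .head ⟨hxy.1, ?_⟩ ih
        rw [Function.update_of_ne (hne y hyt), Function.update_of_ne (hne x (.head hxy hyt))]
        exact hxy.2

theorem exists_isUnitFlow {R : V → V → Prop} {s t : V} (h : ReflTransGen R s t) :
    ∃ g, IsUnitFlow R s t g := by
  obtain ⟨d, hd⟩ := exists_decreasing_of_reflTransGen h
  obtain ⟨g, hg, -⟩ := exists_isUnitFlow_of_decreasing (fun _ _ h => h.2) hd
  exact ⟨g, hg.skew, hg.le_one, fun u v h => (hg.rel u v h).1, hg.sum_eq⟩

theorem IsIntFlow.add_unitFlow {cap : V → V → ℕ} {s t : V} {f g : V → V → ℤ}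
    (hf : IsIntFlow cap s t f) {R : V → V → Prop} (hg : IsUnitFlow R s t g)
    (hR : ∀ u v, R u v → f u v < cap u v) : IsIntFlow cap s t (f + g) where
  skew u v := by simp only [Pi.add_apply]; rw [hf.skew, hg.skew]; ring
  le u v := by
    have h1 := hf.le u v
    have h2 := hg.le_one u v
    simp only [Pi.add_apply]
    by_cases h : 0 < g u v
    · have := hR u v (hg.rel u v h); omega
    · omega
  cons u hs ht := by
    simp [Finset.sum_add_distrib, hf.cons u hs ht, hg.sum_eq, hs, ht]

theorem IsUnitFlow.hasCutWithin {cap : V → V → ℕ} {s t : V} {f g : V → V → ℤ}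
    {R : V → V → Prop} (hg : IsUnitFlow R s t g) (hst : s ≠ t) {j : ℕ}
    (h : HasCutWithin cap s t f (j + 1)) : HasCutWithin cap s t (f + g) j := by
  obtain ⟨X, hs, ht, hX⟩ := h
  refine ⟨X, hs, ht, ?_⟩
  simp only [Pi.add_apply, Finset.sum_add_distrib, hg.sum_eq, hst, if_true, if_false]
  push_cast at hX
  linarith

end Flow

section Labels

variable {V : Type} [Fintype V] [DecidableEq V]

/-- Distance labels for the residual graph of `f`: residual arcs descend by at most one. -/
def IsLabeling (cap : V → V → ℕ) (f : V → V → ℤ) (d : V → ℕ) : Prop :=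
  ∀ u v, f u v < cap u v → d u ≤ d v + 1

/-- The arcs that are residual for every capacity function in `S`. -/
def Residual (S : Set (V → V → ℕ)) (f : V → V → ℤ) (u v : V) : Prop :=
  ∀ cap ∈ S, f u v < cap u v

/-- The arcs known to be residual along which the label drops by exactly one. -/
def Admissible (S : Set (V → V → ℕ)) (f : V → V → ℤ) (d : V → ℕ) (u v : V) : Prop :=
  Residual S f u v ∧ d u = d v + 1

theorem exists_small_consecutive_fibers (d : V → ℕ) {D : ℕ} (hD : 0 < D) :
    ∃ i < D, D * ((Finset.univ.filter (d · = i)).card +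
      (Finset.univ.filter (d · = i + 1)).card) ≤ 2 * Fintype.card V := by
  have hsum : ∀ g : ℕ → ℕ, Function.Injective g →
      ∑ i ∈ Finset.range D, (Finset.univ.filter (d · = g i)).card ≤ Fintype.card V := by
    intro g hg
    rw [← Finset.card_biUnion]
    · exact Finset.card_le_univ _
    · intro i _ j _ hij
      rw [Function.onFun, Finset.disjoint_left]
      intro v hv hv'
      simp only [Finset.mem_filter, Finset.mem_univ, true_and] at hv hv'
      exact hij (hg (hv ▸ hv'))
  by_contra! h
  have h1 := hsum (fun i => i) fun _ _ h => h
  have h2 := hsum (fun i => i + 1) (add_left_injective 1)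
  have h3 : ∑ _i ∈ Finset.range D, 2 * Fintype.card V < ∑ i ∈ Finset.range D,
      D * ((Finset.univ.filter (d · = i)).card + (Finset.univ.filter (d · = i + 1)).card) :=
    Finset.sum_lt_sum_of_nonempty ⟨0, by simpa using hD⟩ fun i hi => h i (by simpa using hi)
  rw [Finset.sum_const, Finset.card_range, smul_eq_mul, ← Finset.mul_sum,
    Finset.sum_add_distrib] at h3
  have := lt_of_mul_lt_mul_left h3 (Nat.zero_le D)
  omega

theorem IsLabeling.hasCutWithin {W : ℕ} {cap : V → V → ℕ} {s t : V} {f : V → V → ℤ} {d : V → ℕ}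
    (hd : IsLabeling cap f d) (hcap : IsNetwork W cap) (hf : IsIntFlow cap s t f)
    {D : ℕ} (hD : 0 < D) (hs : D ≤ d s) (ht : d t = 0) :
    HasCutWithin cap s t f (2 * W * Fintype.card V ^ 2 / D ^ 2) := by
  obtain ⟨i, hi, hsmall⟩ := exists_small_consecutive_fibers d hD
  set a := (Finset.univ.filter (d · = i)).card
  set b := (Finset.univ.filter (d · = i + 1)).card
  have hab : 2 * W * (b * a) ≤ 2 * W * Fintype.card V ^ 2 / D ^ 2 := by
    rw [Nat.le_div_iff_mul_le (by positivity), mul_assoc]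
    refine Nat.mul_le_mul_left _ ?_
    have h1 : (D * (a + b)) ^ 2 ≤ (2 * Fintype.card V) ^ 2 := Nat.pow_le_pow_left hsmall 2
    have h2 : 4 * (b * a) ≤ (a + b) ^ 2 := by
      zify; nlinarith [sq_nonneg ((a : ℤ) - b)]
    have h3 : 4 * (b * a) * D ^ 2 ≤ (a + b) ^ 2 * D ^ 2 := Nat.mul_le_mul_right _ h2
    nlinarith
  set X := Finset.univ.filter fun v => i + 1 ≤ d v with hX
  have hsX : s ∈ X := by simp [hX]; omega
  have htX : t ∉ X := by simp [hX, ht]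
  refine ⟨X, hsX, htX, ?_⟩
  have key : (CutQueryTree.cutVal cap X : ℤ) - ∑ v, f s v ≤ 2 * W * (b * a) := by
    rw [← sum_cut_eq_sum_source hf.skew hf.cons hsX htX]
    unfold CutQueryTree.cutVal
    push_cast
    rw [← Finset.sum_sub_distrib]
    simp_rw [← Finset.sum_sub_distrib]
    calc ∑ u ∈ X, ∑ v ∈ Xᶜ, ((cap u v : ℤ) - f u v)
        ≤ ∑ u ∈ X, ∑ v ∈ Xᶜ,
          (if d u = i + 1 then 1 else 0) * (if d v = i then 2 * (W : ℤ) else 0) := by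
          refine Finset.sum_le_sum fun u hu => Finset.sum_le_sum fun v hv => ?_
          simp only [hX, Finset.mem_compl, Finset.mem_filter, Finset.mem_univ, true_and] at hu hv
          by_cases hres : f u v < cap u v
          · have := hd u v hres
            rw [if_pos (by omega), if_pos (by omega)]
            have h1 := hf.le v u
            have h2 := hf.skew u v
            have h3 := hcap.le u v
            have h4 := hcap.le v u
            omega
          · have : (0 : ℤ) ≤ (if d u = i + 1 then 1 else 0) *
                (if d v = i then 2 * (W : ℤ) else 0) := by positivity
            omega
      _ = (∑ u ∈ X, if d u = i + 1 then 1 else 0) * ∑ v ∈ Xᶜ, if d v = i then 2 * (W : ℤ) else 0 := by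
          rw [Finset.sum_mul_sum]
      _ ≤ (∑ u, if d u = i + 1 then 1 else 0) * ∑ v, if d v = i then 2 * (W : ℤ) else 0 := by
          refine mul_le_mul ?_ ?_ ?_ ?_
          · exact Finset.sum_le_univ_sum_of_nonneg fun _ => by positivity
          · exact Finset.sum_le_univ_sum_of_nonneg fun _ => by positivity
          · exact Finset.sum_nonneg fun _ _ => by positivity
          · exact Finset.sum_nonneg fun _ _ => by positivity
      _ = 2 * W * (b * a) := by
          rw [← Finset.sum_filter, ← Finset.sum_filter]
          simp only [Finset.sum_const, nsmul_eq_mul, a, b]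
          ring
  have hab' : (2 * W * (b * a) : ℤ) ≤ ((2 * W * Fintype.card V ^ 2 / D ^ 2 : ℕ) : ℤ) := by
    exact_mod_cast hab
  linarith

variable {S S' : Set (V → V → ℕ)} {f : V → V → ℤ} {d : V → ℕ}

omit [Fintype V] [DecidableEq V] in
theorem reflTransGen_residual_mono (hS : S' ⊆ S) {u v : V} (h : ReflTransGen (Residual S f) u v) :
    ReflTransGen (Residual S' f) u v :=
  h.lift id fun _ _ h cap hc => h cap (hS hc)

omit [Fintype V] [DecidableEq V] in
theorem reflTransGen_admissible_mono (hS : S' ⊆ S) {u v : V}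
    (h : ReflTransGen (Admissible S f d) u v) : ReflTransGen (Admissible S' f d) u v :=
  h.lift id fun _ _ h => ⟨fun cap hc => h.1 cap (hS hc), h.2⟩

omit [Fintype V] [DecidableEq V] in
theorem label_le_of_admissible {s u : V} (h : ReflTransGen (Admissible S f d) s u) :
    d u ≤ d s := by
  induction h with
  | refl => exact le_rfl
  | tail _ h ih => have := h.2; omega

omit [Fintype V] in
theorem reflTransGen_admissible_update {s u p : V} (h : ReflTransGen (Admissible S f d) s p)
    (hp : d u < d p) (c : ℕ) : ReflTransGen (Admissible S f (Function.update d u c)) s p := by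
  induction h with
  | refl => exact .refl
  | @tail x y _ h ih =>
    have := h.2
    refine (ih (by omega)).tail ⟨h.1, ?_⟩
    rw [Function.update_of_ne (by rintro rfl; omega), Function.update_of_ne (by rintro rfl; omega)]
    exact this

theorem IsLabeling.add_unitFlow {cap : V → V → ℕ} {s t : V} {g : V → V → ℤ}
    (hd : IsLabeling cap f d) (hg : IsUnitFlow (Admissible S f d) s t g) :
    IsLabeling cap (f + g) d := by
  intro u v h
  simp only [Pi.add_apply] at h
  by_cases hlt : f u v < cap u v
  · exact hd u v hlt
  · have := (hg.rel v u (by have := hg.skew u v; omega)).2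
    omega

omit [Fintype V] in
theorem IsLabeling.relabel {cap : V → V → ℕ} (hd : IsLabeling cap f d) {u : V}
    (h : ∀ v, d v + 1 = d u → (cap u v : ℤ) ≤ f u v) :
    IsLabeling cap f (Function.update d u (d u + 1)) := by
  intro x y hxy
  have h1 := hd x y hxy
  by_cases hx : x = u
  · subst hx
    have h2 : d y + 1 ≠ d x := fun hy => absurd (h y hy) (by omega)
    by_cases hy : y = x
    · subst hy; omega
    · rw [Function.update_self, Function.update_of_ne hy]; omega
  · rw [Function.update_of_ne hx]
    by_cases hy : y = u
    · subst hy; rw [Function.update_self]; omega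
    · rw [Function.update_of_ne hy]; exact h1

end Labels

section Algorithm

variable {V : Type} [Fintype V] [DecidableEq V] {W m : ℕ} {s t : V}

open CutQueryTree

/-- Growing the set `R` of vertices known to be reachable from `s`, where `A ⊆ R` is the set of
vertices already known to have no residual arc leaving `R`. -/
theorem solvable_of_reachable {k : ℕ} {f : V → V → ℤ} (hm : Fintype.card V ≤ 2 ^ m) (N : ℕ) :
    ∀ (S : Set (V → V → ℕ)) (R A : Finset V),
      (∀ cap ∈ S, IsNetwork W cap) → (∀ cap ∈ S, IsIntFlow cap s t f) → s ∈ R → A ⊆ R →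
      2 * Fintype.card V ≤ N + R.card + A.card →
      (∀ v ∈ R, ReflTransGen (Residual S f) s v) →
      (∀ cap ∈ S, ∀ u ∈ A, ∀ v ∉ R, (cap u v : ℤ) ≤ f u v) →
      (∀ S' ⊆ S, ReflTransGen (Residual S' f) s t →
        Solvable (fun cap => IsMaxFlow cap s t) S' k) →
      Solvable (fun cap => IsMaxFlow cap s t) S (k + N * (3 * (m + 1))) := by
  induction N with
  | zero =>
    intro S R A _ hf hs _ hN hR hA hcont
    have h1 := Finset.card_le_univ R
    have h2 := Finset.card_le_univ A
    have hRu : R = Finset.univ := Finset.eq_univ_of_card R (by omega)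
    exact hcont S subset_rfl (hR t (by simp [hRu])) |>.mono subset_rfl (by omega)
  | succ N ih =>
    intro S R A hnet hf hs hAR hN hR hA hcont
    by_cases ht : t ∈ R
    · exact (hcont S subset_rfl (hR t ht)).mono subset_rfl (by omega)
    by_cases hRA : R ⊆ A
    · refine Solvable.of_output (fun u v => (f u v : ℝ)) fun cap hc => (hf cap hc).isMaxFlow
        ⟨R, hs, ht, ?_⟩
      rw [← sum_cut_eq_sum_source (hf cap hc).skew (hf cap hc).cons hs ht]
      unfold cutVal
      push_cast
      rw [add_zero]
      exact Finset.sum_le_sum fun u hu => Finset.sum_le_sum fun v hv =>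
        hA cap hc u (hRA hu) v (by simpa using hv)
    obtain ⟨u, huR, huA⟩ := Finset.not_subset.1 hRA
    rw [show k + (N + 1) * (3 * (m + 1)) = k + N * (3 * (m + 1)) + 3 * (m + 1) by ring]
    refine Solvable.search (fun cap hc => (hnet cap hc).symm) (f := f)
      (fun cap hc => (hf cap hc).le) (u := u) (A := Rᶜ) (by simpa using huR)
      ((Finset.card_le_univ _).trans hm) ?_ ?_
    · refine ih _ R (insert u A) (fun c hc => hnet c hc.1) (fun c hc => hf c hc.1) hs
        (Finset.insert_subset huR hAR) (by rw [Finset.card_insert_of_notMem huA]; omega)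
        (fun v hv => reflTransGen_residual_mono (fun _ hc => hc.1) (hR v hv)) ?_
        fun S' hS' => hcont S' (hS'.trans fun _ hc => hc.1)
      rintro cap ⟨hc, hcu⟩ x hx v hv
      rcases Finset.mem_insert.1 hx with rfl | hx
      · exact hcu v (by simpa using hv)
      · exact hA cap hc x hx v hv
    · intro v hv
      have hv : v ∉ R := by simpa using hv
      refine ih _ (insert v R) A (fun c hc => hnet c hc.1) (fun c hc => hf c hc.1)
        (Finset.mem_insert_of_mem hs) (hAR.trans (Finset.subset_insert _ _))
        (by rw [Finset.card_insert_of_notMem hv]; omega) ?_ ?_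
        fun S' hS' => hcont S' (hS'.trans fun _ hc => hc.1)
      · have hR' : ∀ x ∈ R, ReflTransGen (Residual {cap ∈ S | f u v < cap u v} f) s x :=
          fun x hx => reflTransGen_residual_mono (fun _ hc => hc.1) (hR x hx)
        intro x hx
        rcases Finset.mem_insert.1 hx with rfl | hx
        · exact (hR' u huR).tail fun cap hc => hc.2
        · exact hR' x hx
      · rintro cap ⟨hc, -⟩ x hx y hy
        exact hA cap hc x hx y fun hyR => hy (Finset.mem_insert_of_mem hyR)

/-- Completing a flow that is within `j` of being maximum, one unit at a time. -/
theorem solvable_of_hasCutWithin (hm : Fintype.card V ≤ 2 ^ m) (hst : s ≠ t) (j : ℕ) :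
    ∀ (S : Set (V → V → ℕ)) (f : V → V → ℤ),
      (∀ cap ∈ S, IsNetwork W cap) → (∀ cap ∈ S, IsIntFlow cap s t f) →
      (∀ cap ∈ S, HasCutWithin cap s t f j) →
      Solvable (fun cap => IsMaxFlow cap s t) S
        (j * (2 * Fintype.card V * (3 * (m + 1)))) := by
  induction j with
  | zero =>
    exact fun S f _ hf hcut => Solvable.of_output (fun u v => (f u v : ℝ))
      fun cap hc => (hf cap hc).isMaxFlow (hcut cap hc)
  | succ j ih =>
    intro S f hnet hf hcut
    rw [add_one_mul]
    refine solvable_of_reachable hm _ S {s} ∅ hnet hf (by simp) (by simp) (by omega) ?_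
      (by simp) ?_
    · intro v hv
      rw [Finset.mem_singleton.1 hv]
    · intro S' hS' hreach
      obtain ⟨g, hg⟩ := exists_isUnitFlow hreach
      exact ih S' (f + g) (fun c hc => hnet c (hS' hc))
        (fun c hc => (hf c (hS' hc)).add_unitFlow hg fun u v h => h c hc)
        fun c hc => hg.hasCutWithin hst (hcut c (hS' hc))

/-- Augmentation along shortest paths with distance labels at most `D`: the labels `d` are valid,
an admissible path from `s` to `u` is known, and at most `b` augmentations remain. -/
theorem solvable_of_labeling {D k : ℕ} (hD : 0 < D) (hm : Fintype.card V ≤ 2 ^ m) (hst : s ≠ t)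
    (hcont : ∀ (S : Set (V → V → ℕ)) (f : V → V → ℤ),
      (∀ cap ∈ S, IsNetwork W cap) → (∀ cap ∈ S, IsIntFlow cap s t f) →
      (∀ cap ∈ S, HasCutWithin cap s t f (2 * W * Fintype.card V ^ 2 / D ^ 2)) →
      Solvable (fun cap => IsMaxFlow cap s t) S k) (N : ℕ) :
    ∀ (S : Set (V → V → ℕ)) (f : V → V → ℤ) (d : V → ℕ) (u : V) (b : ℕ),
      (∀ cap ∈ S, IsNetwork W cap) → (∀ cap ∈ S, IsIntFlow cap s t f) →
      (∀ cap ∈ S, HasCutWithin cap s t f b) → (∀ cap ∈ S, IsLabeling cap f d) →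
      d t = 0 → (∀ v, d v ≤ D) → ReflTransGen (Admissible S f d) s u →
      2 * (Fintype.card V * D) + b * (D + 2) + D + d u ≤ N + 2 * ∑ v, d v + d s →
      Solvable (fun cap => IsMaxFlow cap s t) S (k + N * (3 * (m + 1))) := by
  induction N with
  | zero =>
    intro S f d u b hnet hf _ hlab ht hdD _ hN
    have h1 : ∑ v, d v ≤ Fintype.card V * D := by
      simpa using Finset.sum_le_sum fun v (_ : v ∈ Finset.univ) => hdD v
    refine (hcont S f hnet hf fun c hc => ?_).mono subset_rfl (by omega)
    exact (hlab c hc).hasCutWithin (hnet c hc) (hf c hc) hD (by omega) ht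
  | succ N ih =>
    intro S f d u b hnet hf hcut hlab ht hdD hpath hN
    by_cases hs : D ≤ d s
    · exact (hcont S f hnet hf fun c hc => (hlab c hc).hasCutWithin (hnet c hc) (hf c hc) hD hs
        ht).mono subset_rfl (by omega)
    by_cases hut : u = t
    · subst hut
      rcases S.eq_empty_or_nonempty with rfl | ⟨cap, hc⟩
      · exact Solvable.of_output 0 (by simp)
      obtain ⟨g, hg, -⟩ := exists_isUnitFlow_of_decreasing
        (d := d) (fun x y h => by have := h.2; omega) hpath
      have hf' : ∀ c ∈ S, IsIntFlow c s u (f + g) := fun c hc =>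
        (hf c hc).add_unitFlow hg fun x y h => h.1 c hc
      obtain ⟨b, rfl⟩ : ∃ b', b = b' + 1 := by
        refine ⟨b - 1, ?_⟩
        by_contra hb
        obtain rfl : b = 0 := by omega
        obtain ⟨X, hsX, htX, hX⟩ := hcut cap hc
        have := (hf' cap hc).sum_source_le hsX htX
        simp only [Pi.add_apply, Finset.sum_add_distrib, hg.sum_eq, hst, if_true, if_false] at this
        push_cast at hX
        omega
      refine (ih S (f + g) d s b hnet hf' (fun c hc => hg.hasCutWithin hst (hcut c hc))
        (fun c hc => (hlab c hc).add_unitFlow hg) ht hdD .refl ?_).mono subset_rfl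
        (by rw [add_one_mul]; omega)
      rw [add_one_mul] at hN
      omega
    rw [show k + (N + 1) * (3 * (m + 1)) = k + N * (3 * (m + 1)) + 3 * (m + 1) by ring]
    refine Solvable.search (fun cap hc => (hnet cap hc).symm) (f := f)
      (fun cap hc => (hf cap hc).le) (u := u) (A := Finset.univ.filter fun v => d v + 1 = d u)
      (by simp) ((Finset.card_le_univ _).trans hm) ?_ ?_
    · have hus := label_le_of_admissible hpath
      have hsum : ∑ v, Function.update d u (d u + 1) v = ∑ v, d v + 1 := by
        rw [Finset.sum_update_of_mem (Finset.mem_univ u),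
          ← Finset.add_sum_erase _ d (Finset.mem_univ u), Finset.sdiff_singleton_eq_erase]
        ring
      have step : ∀ p, ReflTransGen (Admissible {cap ∈ S | ∀ v ∈ Finset.univ.filter
            (fun v => d v + 1 = d u), (cap u v : ℤ) ≤ f u v} f (Function.update d u (d u + 1))) s p →
          Function.update d u (d u + 1) p + d s ≤ d u + 1 + Function.update d u (d u + 1) s →
          Solvable (fun cap => IsMaxFlow cap s t) {cap ∈ S | ∀ v ∈ Finset.univ.filter
            (fun v => d v + 1 = d u), (cap u v : ℤ) ≤ f u v} (k + N * (3 * (m + 1))) := by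
        intro p hp hps
        refine ih _ f _ p b (fun c hc => hnet c hc.1) (fun c hc => hf c hc.1)
          (fun c hc => hcut c hc.1)
          (fun c hc => (hlab c hc.1).relabel fun v hv => hc.2 v (by simpa using hv)) ?_ ?_ hp ?_
        · rw [Function.update_of_ne (Ne.symm hut), ht]
        · intro v
          by_cases hv : v = u
          · subst hv; rw [Function.update_self]; omega
          · rw [Function.update_of_ne hv]; exact hdD v
        · rw [hsum]; omega
      rcases hpath.cases_tail with hsu | ⟨p, hp, hpu⟩
      · subst hsu
        exact step u .refl (by simp)
      · have hdp := hpu.2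
        have hps := label_le_of_admissible hp
        refine step p (reflTransGen_admissible_mono (fun _ hc => hc.1)
          (reflTransGen_admissible_update hp (by omega) _)) ?_
        rw [Function.update_of_ne (by rintro rfl; omega),
          Function.update_of_ne (by rintro rfl; omega)]
        omega
    · intro v hv
      have hv : d v + 1 = d u := by simpa using hv
      refine ih _ f d v b (fun c hc => hnet c hc.1) (fun c hc => hf c hc.1)
        (fun c hc => hcut c hc.1) (fun c hc => hlab c hc.1) ht hdD ?_ (by omega)
      exact (reflTransGen_admissible_mono (fun _ hc => hc.1) hpath).tail
        ⟨fun c hc => hc.2, hv.symm⟩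

theorem solvable_isNetwork {D : ℕ} (hD : 0 < D) (hm : Fintype.card V ≤ 2 ^ m) (hst : s ≠ t) :
    Solvable (fun cap => IsMaxFlow cap s t) {cap : V → V → ℕ | IsNetwork W cap}
      (2 * W * Fintype.card V ^ 2 / D ^ 2 * (2 * Fintype.card V * (3 * (m + 1))) +
        (2 * (Fintype.card V * D) + Fintype.card V * W * (D + 2) + D) * (3 * (m + 1))) := by
  refine solvable_of_labeling hD hm hst (solvable_of_hasCutWithin hm hst _) _ _ 0 0 s
    (Fintype.card V * W) (fun _ h => h) (fun c _ => ⟨by simp, by simp, by simp⟩) ?_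
    (fun _ _ _ _ _ => by simp) rfl (by simp) .refl (by simp)
  intro c hc
  refine ⟨{s}, by simp, by simpa using hst.symm, ?_⟩
  have h : cutVal c {s} ≤ Fintype.card V * W := by
    unfold cutVal
    rw [Finset.sum_singleton]
    calc ∑ v ∈ ({s} : Finset V)ᶜ, c s v ≤ ∑ v ∈ ({s} : Finset V)ᶜ, W :=
          Finset.sum_le_sum fun v _ => hc.le s v
      _ ≤ Fintype.card V * W := by
          rw [Finset.sum_const, smul_eq_mul]
          exact Nat.mul_le_mul_right _ (Finset.card_le_univ _)
  simpa using (Int.ofNat_le.2 h)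

end Algorithm

theorem depth_bound {n W : ℕ} (hn : 2 ≤ n) (hW : 1 ≤ W) :
    ((2 * W * n ^ 2 / ⌈(n : ℝ) ^ ((2 : ℝ) / 3)⌉₊ ^ 2 * (2 * n * (3 * ((Nat.log 2 n).succ + 1))) +
        (2 * (n * ⌈(n : ℝ) ^ ((2 : ℝ) / 3)⌉₊) + n * W * (⌈(n : ℝ) ^ ((2 : ℝ) / 3)⌉₊ + 2) +
          ⌈(n : ℝ) ^ ((2 : ℝ) / 3)⌉₊) * (3 * ((Nat.log 2 n).succ + 1)) : ℕ) : ℝ) ≤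
      252 * (n : ℝ) ^ ((5 : ℝ) / 3) * (W : ℝ) * (Real.log n) ^ 1 := by
  have hn' : (2 : ℝ) ≤ n := by exact_mod_cast hn
  have hn0 : (0 : ℝ) ≤ n := by positivity
  obtain ⟨x, hx, hxn⟩ : ∃ x : ℝ, 1 ≤ x ∧ x = (n : ℝ) ^ ((1 : ℝ) / 3) :=
    ⟨_, Real.one_le_rpow (by linarith) (by norm_num), rfl⟩
  have hx3 : (n : ℝ) = x ^ 3 := by
    rw [hxn, ← Real.rpow_natCast, ← Real.rpow_mul hn0]; norm_num
  have hx2 : (n : ℝ) ^ ((2 : ℝ) / 3) = x ^ 2 := by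
    rw [hxn, ← Real.rpow_natCast, ← Real.rpow_mul hn0]; norm_num
  have hx5 : (n : ℝ) ^ ((5 : ℝ) / 3) = x ^ 5 := by
    rw [hxn, ← Real.rpow_natCast, ← Real.rpow_mul hn0]; norm_num
  rw [hx2, hx5, pow_one]
  set D := ⌈x ^ 2⌉₊
  have hD1 : x ^ 2 ≤ D := Nat.le_ceil _
  have hx21 : 1 ≤ x ^ 2 := one_le_pow₀ hx
  have hD2 : (D : ℝ) ≤ 2 * x ^ 2 := by
    have := Nat.ceil_lt_add_one (a := x ^ 2) (by positivity)
    linarith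
  have hJ : ((2 * W * n ^ 2 / D ^ 2 : ℕ) : ℝ) ≤ 2 * W * x ^ 2 := by
    refine Nat.cast_div_le.trans ?_
    have hDpos : (0 : ℝ) < D := by linarith
    push_cast
    rw [div_le_iff₀ (by positivity), hx3]
    have : (x ^ 2) ^ 2 ≤ (D : ℝ) ^ 2 := pow_le_pow_left₀ (by positivity) hD1 2
    calc 2 * (W : ℝ) * (x ^ 3) ^ 2 = 2 * W * x ^ 2 * (x ^ 2) ^ 2 := by ring
      _ ≤ 2 * W * x ^ 2 * D ^ 2 := by gcongr
  have hlog : (3 * ((Nat.log 2 n).succ + 1) : ℝ) ≤ 18 * Real.log n := by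
    have h2 : 1 / 2 < Real.log 2 := by have := Real.log_two_gt_d9; linarith
    have h3 : Real.log 2 ≤ Real.log n := Real.log_le_log (by norm_num) hn'
    have h4 : (Nat.log 2 n : ℝ) * Real.log 2 ≤ Real.log n := by
      rw [← Real.log_pow]
      refine Real.log_le_log (by positivity) ?_
      exact_mod_cast Nat.pow_log_le_self 2 (by omega)
    have h5 : (0 : ℝ) ≤ Nat.log 2 n := by positivity
    push_cast
    nlinarith
  have hW' : (1 : ℝ) ≤ W := by exact_mod_cast hW
  have hx25 : x ^ 2 ≤ x ^ 5 := pow_le_pow_right₀ hx (by norm_num)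
  have hmain : ((2 * W * n ^ 2 / D ^ 2 : ℕ) : ℝ) * (2 * n) +
      (2 * (n * D) + n * W * (D + 2) + D) ≤ 14 * x ^ 5 * W := by
    have e1 : ((2 * W * n ^ 2 / D ^ 2 : ℕ) : ℝ) * (2 * n) ≤ 2 * W * x ^ 2 * (2 * n) := by gcongr
    have e2 : (2 * (n * D) : ℝ) ≤ 2 * (n * (2 * x ^ 2)) := by gcongr
    have e3 : (n * W * (D + 2) : ℝ) ≤ n * W * (4 * x ^ 2) := by gcongr; linarith
    have e4 : x ^ 5 ≤ x ^ 5 * W := le_mul_of_one_le_right (by positivity) hW'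
    rw [hx3] at e1 e2 e3 ⊢
    nlinarith
  calc _ = (((2 * W * n ^ 2 / D ^ 2 : ℕ) : ℝ) * (2 * n) +
      (2 * (n * D) + n * W * (D + 2) + D)) * (3 * ((Nat.log 2 n).succ + 1)) := by
        push_cast; ring
    _ ≤ 14 * x ^ 5 * W * (18 * Real.log n) := by gcongr
    _ = 252 * x ^ 5 * W * Real.log n := by ring

/-- There exist constants `C > 0` and `c ≥ 0` such that for every
`n ≥ 2`, every `W ≥ 1`, every finite vertex set `V` with `|V| = n`, and all
distinct `s, t ∈ V`, there is a deterministic cut-query decision tree over `V`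
of depth at most `C·n^{5/3}·W·(log n)^c` which, for every capacitated
undirected graph on `V` with integer capacities bounded by `W`, outputs a
maximum `s`-`t` flow. -/
theorem deterministic_maxflow_cut_queries :
    ∃ (C : ℝ) (c : ℕ), 0 < C ∧
      ∀ (n W : ℕ), 2 ≤ n → 1 ≤ W →
        ∀ (V : Type) [Fintype V] [DecidableEq V], Fintype.card V = n →
          ∀ s t : V, s ≠ t →
            ∃ (T : CutQueryTree V (V → V → ℝ)) (d : ℕ),
              CutQueryTree.DepthLE T d ∧
              (d : ℝ) ≤ C * (n : ℝ) ^ ((5 : ℝ) / 3) * (W : ℝ) * (Real.log n) ^ c ∧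
              ∀ cap : V → V → ℕ,
                (∀ u v, cap u v = cap v u) →
                (∀ v, cap v v = 0) →
                (∀ u v, cap u v ≤ W) →
                IsFlow cap s t (T.run (fun Q => ∑ u ∈ Q, ∑ v ∈ Qᶜ, cap u v)) ∧
                ∀ g : V → V → ℝ, IsFlow cap s t g →
                  ∑ v, g s v ≤ ∑ v, (T.run (fun Q => ∑ u ∈ Q, ∑ v ∈ Qᶜ, cap u v)) s v := by
  refine ⟨252, 1, by norm_num, fun n W hn hW V _ _ hV s t hst => ?_⟩
  subst hV
  have hD : 0 < ⌈(Fintype.card V : ℝ) ^ ((2 : ℝ) / 3)⌉₊ := Nat.ceil_pos.2 (by positivity)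
  obtain ⟨T, hT, hmax⟩ := solvable_isNetwork (W := W) hD
    (Nat.lt_pow_succ_log_self one_lt_two (Fintype.card V)).le hst
  refine ⟨T, _, hT, depth_bound hn hW, fun cap h1 h2 h3 => hmax cap ⟨h1, h2, h3⟩⟩
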